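/- Let A be a unital commutative k-algebra. The λ-TD shuffle product ⧢ on Ш(A) = ⊕_{n≥0} A^{⊗n} is commutative: 𝔞 ⧢ 𝔟 = 𝔟 ⧢ 𝔞 for all 𝔞, 𝔟 ∈ Ш(A). -/

import Mathlib

/-!
Common setup: the `λ`-TD shuffle product on `Ш(A) = ⊕_{n ≥ 0} A^{⊗n}` over a commutative
ring `k`, where `A` is a unital commutative `k`-algebra and `A^{⊗0} = k`.  Pure tensors of
positive length are written `Fin.cons a f`, the operation "prepend `a`", i.e. `a ⊗ (–)`,
is implemented as multiplication by the degree-one element `shIota k A a` in the graded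
(concatenation) algebra `⊕_{n ≥ 0} A^{⊗n}`.
-/

open scoped TensorProduct DirectSum
open PiTensorProduct

noncomputable section

variable (k A : Type*) [CommRing k] [CommRing A] [Algebra k A]

/-- The shuffle module `Ш(A) = ⊕_{n ≥ 0} A^{⊗n}` (with `A^{⊗0} = k`). -/
abbrev ShuffleModule : Type _ := ⨁ n : ℕ, ⨂[k]^n A

/-- The pure tensor `a₁ ⊗ ⋯ ⊗ aₙ ∈ A^{⊗n} ⊆ Ш(A)`. -/
def shEmb {n : ℕ} (f : Fin n → A) : ShuffleModule k A :=
  DirectSum.lof k ℕ (fun n => ⨂[k]^n A) n (tprod k f)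

/-- The inclusion of `A^{⊗0} = k` into `Ш(A)`. -/
def shDeg0 (v : ⨂[k]^0 A) : ShuffleModule k A :=
  DirectSum.lof k ℕ (fun n => ⨂[k]^n A) 0 v

/-- Length-one pure tensors, as a linear map `A →ₗ[k] Ш(A)`. -/
def shIota : A →ₗ[k] ShuffleModule k A :=
  (DirectSum.lof k ℕ (fun n => ⨂[k]^n A) 1).comp
    ((MultilinearMap.ofSubsingleton k A (⨂[k]^1 A) (0 : Fin 1)).symm (tprod k))

/-- The element `1_A ∈ A ⊆ Ш(A)`. -/
def shOneA : ShuffleModule k A := shIota k A (1 : A)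

variable (lam : k)

/-- `sh` is the `λ`-TD shuffle product on `Ш(A) = ⊕_{n≥0} A^{⊗n}`: it is `k`-bilinear, acts
by scalar multiplication when one of the arguments lies in `A^{⊗0} = k`, and for pure tensors
`𝔞 = a₁ ⊗ 𝔞'`, `𝔟 = b₁ ⊗ 𝔟'` of positive lengths it satisfies the recursion
`𝔞 ⧢ 𝔟 = a₁ ⊗ (𝔞' ⧢ 𝔟) + b₁ ⊗ (𝔞 ⧢ 𝔟') + λ·a₁b₁ ⊗ (𝔞' ⧢ 𝔟') − a₁b₁ ⊗ ((𝔞' ⧢ 1_A) ⧢ 𝔟')`. -/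
structure IsLambdaTDShuffle
    (sh : ShuffleModule k A →ₗ[k] ShuffleModule k A →ₗ[k] ShuffleModule k A) : Prop where
  scalar_left : ∀ (v : ⨂[k]^0 A) (x : ShuffleModule k A),
    sh (shDeg0 k A v) x = (isEmptyEquiv (Fin 0) v) • x
  scalar_right : ∀ (v : ⨂[k]^0 A) (x : ShuffleModule k A),
    sh x (shDeg0 k A v) = (isEmptyEquiv (Fin 0) v) • x
  shuffle_rec : ∀ {m n : ℕ} (a b : A) (f : Fin m → A) (g : Fin n → A),
    sh (shEmb k A (Fin.cons a f)) (shEmb k A (Fin.cons b g)) =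
      shIota k A a * sh (shEmb k A f) (shEmb k A (Fin.cons b g))
      + shIota k A b * sh (shEmb k A (Fin.cons a f)) (shEmb k A g)
      + lam • (shIota k A (a * b) * sh (shEmb k A f) (shEmb k A g))
      - shIota k A (a * b) * sh (sh (shEmb k A f) (shOneA k A)) (shEmb k A g)

end

noncomputable section
variable {k A : Type*} [CommRing k] [CommRing A] [Algebra k A] {lam : k}

theorem shIota_apply (a : A) : shIota k A a = shEmb k A (fun _ : Fin 1 => a) := by
  simp only [shIota, shEmb, LinearMap.comp_apply]
  rfl

theorem shIota_mul_shEmb {n : ℕ} (a : A) (f : Fin n → A) :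
    shIota k A a * shEmb k A f = shEmb k A (Fin.cons a f) := by
  rw [shIota_apply]
  simp only [shEmb, DirectSum.lof_eq_of, DirectSum.of_mul_of]
  apply DirectSum.of_eq_of_gradedMonoid_eq
  refine TensorPower.gradedMonoid_eq_of_cast (Nat.add_comm 1 n) ?_
  refine (congrArg (TensorPower.cast k A (Nat.add_comm 1 n))
    (TensorPower.tprod_mul_tprod k (fun _ : Fin 1 => a) f)).trans ?_
  rw [TensorPower.cast_tprod, Fin.append_left_eq_cons]
  congr 1

theorem shOneA_eq (e : Fin 0 → A) : shOneA k A = shEmb k A (Fin.cons 1 e) := by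
  rw [shOneA, shIota_apply]
  congr 1
  ext i
  rw [Subsingleton.elim i 0, Fin.cons_zero]

namespace IsLambdaTDShuffle

variable {sh : ShuffleModule k A →ₗ[k] ShuffleModule k A →ₗ[k] ShuffleModule k A}

theorem shEmb_zero_left (hsh : IsLambdaTDShuffle k A lam sh) (e : Fin 0 → A)
    (x : ShuffleModule k A) : sh (shEmb k A e) x = x := by
  have h := hsh.scalar_left (tprod k e) x
  rwa [isEmptyEquiv_apply_tprod, one_smul] at h

theorem shEmb_zero_right (hsh : IsLambdaTDShuffle k A lam sh) (e : Fin 0 → A)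
    (x : ShuffleModule k A) : sh x (shEmb k A e) = x := by
  have h := hsh.scalar_right (tprod k e) x
  rwa [isEmptyEquiv_apply_tprod, one_smul] at h

theorem shEmb_cons_shOneA (hsh : IsLambdaTDShuffle k A lam sh) {m : ℕ} (a : A)
    (f : Fin m → A) :
    sh (shEmb k A (Fin.cons a f)) (shOneA k A) =
      shIota k A 1 * shEmb k A (Fin.cons a f) + lam • shEmb k A (Fin.cons a f) := by
  have h := hsh.shuffle_rec a 1 f Fin.elim0
  rw [← shOneA_eq] at h
  simp only [hsh.shEmb_zero_right, mul_one] at h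
  rw [h, shIota_mul_shEmb a f]
  abel

theorem shOneA_shEmb_cons (hsh : IsLambdaTDShuffle k A lam sh) {m : ℕ} (a : A)
    (f : Fin m → A) :
    sh (shOneA k A) (shEmb k A (Fin.cons a f)) =
      shIota k A 1 * shEmb k A (Fin.cons a f) + lam • shEmb k A (Fin.cons a f) := by
  have h := hsh.shuffle_rec 1 a Fin.elim0 f
  rw [← shOneA_eq] at h
  simp only [hsh.shEmb_zero_left, one_mul] at h
  rw [h, shIota_mul_shEmb a f]
  abel

theorem shOneA_comm (hsh : IsLambdaTDShuffle k A lam sh) {n : ℕ} (g : Fin n → A) :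
    sh (shOneA k A) (shEmb k A g) = sh (shEmb k A g) (shOneA k A) := by
  cases n with
  | zero => rw [hsh.shEmb_zero_left, hsh.shEmb_zero_right]
  | succ n =>
    rw [← Fin.cons_self_tail g, hsh.shOneA_shEmb_cons, hsh.shEmb_cons_shOneA]

/-- Prepending `1_A` commutes with `⧢` in the left argument, in positive lengths. -/
theorem one_mul_shEmb_cons (hsh : IsLambdaTDShuffle k A lam sh) {m n : ℕ} (a b : A)
    (f : Fin m → A) (g : Fin n → A) :
    sh (shIota k A 1 * shEmb k A (Fin.cons a f)) (shEmb k A (Fin.cons b g)) =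
      shIota k A 1 * sh (shEmb k A (Fin.cons a f)) (shEmb k A (Fin.cons b g)) := by
  rw [shIota_mul_shEmb, hsh.shuffle_rec 1 b, hsh.shEmb_cons_shOneA, shIota_mul_shEmb]
  simp only [one_mul, map_add, map_smul, LinearMap.add_apply, LinearMap.smul_apply, mul_add,
    mul_smul_comm]
  abel

/-- The term `(𝔞 ⧢ 1_A) ⧢ 𝔟` is symmetric as soon as `𝔞` and `𝔟` commute. -/
theorem shOneA_shuffle_symm (hsh : IsLambdaTDShuffle k A lam sh) {m n : ℕ}
    (f : Fin m → A) (g : Fin n → A)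
    (h : sh (shEmb k A f) (shEmb k A g) = sh (shEmb k A g) (shEmb k A f)) :
    sh (sh (shEmb k A f) (shOneA k A)) (shEmb k A g) =
      sh (sh (shEmb k A g) (shOneA k A)) (shEmb k A f) := by
  cases m with
  | zero => rw [hsh.shEmb_zero_left, hsh.shEmb_zero_right, hsh.shOneA_comm]
  | succ m =>
    cases n with
    | zero => rw [hsh.shEmb_zero_left, hsh.shEmb_zero_right, hsh.shOneA_comm]
    | succ n =>
      rw [← Fin.cons_self_tail f, ← Fin.cons_self_tail g] at h ⊢
      rw [hsh.shEmb_cons_shOneA, hsh.shEmb_cons_shOneA]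
      simp only [map_add, map_smul, LinearMap.add_apply, LinearMap.smul_apply,
        hsh.one_mul_shEmb_cons, h]

theorem shEmb_comm (hsh : IsLambdaTDShuffle k A lam sh) {m : ℕ} (f : Fin m → A) {n : ℕ}
    (g : Fin n → A) : sh (shEmb k A f) (shEmb k A g) = sh (shEmb k A g) (shEmb k A f) := by
  induction m generalizing n with
  | zero => rw [hsh.shEmb_zero_left, hsh.shEmb_zero_right]
  | succ m ihm =>
    induction n with
    | zero => rw [hsh.shEmb_zero_left, hsh.shEmb_zero_right]
    | succ n ihn =>
      cases f using Fin.consCases with | _ a f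
      cases g using Fin.consCases with | _ b g
      rw [hsh.shuffle_rec, hsh.shuffle_rec, ihm, ihn, ihm f g,
        hsh.shOneA_shuffle_symm f g (ihm f g), mul_comm a]
      abel

end IsLambdaTDShuffle

/-- The `λ`-TD shuffle product `⧢` on `Ш(A) = ⊕_{n≥0} A^{⊗n}` is
commutative: `𝔞 ⧢ 𝔟 = 𝔟 ⧢ 𝔞` for all `𝔞, 𝔟 ∈ Ш(A)`. -/
theorem lambdaTDShuffle_comm
    (sh : ShuffleModule k A →ₗ[k] ShuffleModule k A →ₗ[k] ShuffleModule k A)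
    (hsh : IsLambdaTDShuffle k A lam sh) :
    ∀ x y : ShuffleModule k A, sh x y = sh y x := by
  suffices h : sh = sh.flip from fun x y => LinearMap.congr_fun₂ h x y
  ext m f n g
  exact DFunLike.congr_fun (hsh.shEmb_comm f g) _

end
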